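/- Let C, D ∈ Σ be such that (i) there exists an index i with C e_i = e_i and D e_i = e_i, and (ii) the interiors of C[Δ] and D[Δ] relative to Δ do not intersect. Then there exists a matrix E in the monoid generated by C and D (a nonempty product of copies of C and D) such that the intersection over t ≥ 0 of E^t[Δ] is not a singleton. -/

import Mathlib

open Matrix

abbrev MatZ (n : ℕ) : Type := Matrix (Fin (n + 1)) (Fin (n + 1)) ℤ

def inSigma {n : ℕ} (A : MatZ n) : Prop :=
  IsUnit A.det ∧ ∀ i j, 0 ≤ A i j

def IsPermMat {n : ℕ} (A : MatZ n) : Prop :=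
  ∃ σ : Equiv.Perm (Fin (n + 1)), ∀ i j, A i j = if i = σ j then 1 else 0

noncomputable def toR {n : ℕ} (A : MatZ n) : Matrix (Fin (n + 1)) (Fin (n + 1)) ℝ :=
  A.map ((↑) : ℤ → ℝ)

noncomputable def projAct {n : ℕ} (A : Matrix (Fin (n + 1)) (Fin (n + 1)) ℝ)
    (x : Fin (n + 1) → ℝ) : Fin (n + 1) → ℝ :=
  (∑ i, (A *ᵥ x) i)⁻¹ • (A *ᵥ x)

noncomputable def simg {n : ℕ} (A : MatZ n) : Set (Fin (n + 1) → ℝ) :=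
  projAct (toR A) '' stdSimplex ℝ (Fin (n + 1))

def wordProd {n : ℕ} (A0 A1 : MatZ n) (w : List Bool) : MatZ n :=
  (w.map (fun b => bif b then A1 else A0)).prod

def Contractive {n : ℕ} (A0 A1 : MatZ n) : Prop :=
  ∀ a : ℕ → Bool, ∃ p,
    (⋂ t : ℕ, simg (wordProd A0 A1 ((List.range t).map a))) = {p}

def Nmat (n : ℕ) : MatZ n :=
  Matrix.of fun i j => if i = j then 1 else if j = 1 ∧ i = 0 then 1 else 0

def Fmat (n : ℕ) : MatZ n :=
  Matrix.of fun i j => if i = Equiv.swap (0 : Fin (n + 1)) 1 j then 1 else 0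

def Rmat (n : ℕ) : MatZ n :=
  Matrix.of fun i j => if i = j + 1 then 1 else 0

def Lmat (n : ℕ) : MatZ n := Fmat n * Nmat n * Fmat n

def Mon0 (n : ℕ) : MatZ n := Nmat n * Fmat n * Rmat n

def Mon1 (n : ℕ) : MatZ n := Lmat n * Rmat n

def permMat {n : ℕ} (σ : Equiv.Perm (Fin (n + 1))) : MatZ n :=
  Matrix.of fun i j => if i = σ j then 1 else 0


namespace S10

lemma toR_mul {n : ℕ} (A B : MatZ n) : toR (A * B) = toR A * toR B := by
  unfold toR
  exact Matrix.map_mul (f := Int.castRingHom ℝ)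

lemma toR_one {n : ℕ} : toR (1 : MatZ n) = 1 := by
  unfold toR
  exact Matrix.map_one _ (by simp) (by simp)

lemma toR_pow {n : ℕ} (A : MatZ n) (t : ℕ) : toR (A ^ t) = toR A ^ t := by
  induction t with
  | zero => simp [toR_one]
  | succ k ih => rw [pow_succ, pow_succ, toR_mul, ih]

lemma toR_det {n : ℕ} (A : MatZ n) : (toR A).det = (A.det : ℝ) := by
  unfold toR
  exact ((Int.castRingHom ℝ).map_det A).symm

lemma toR_unit {n : ℕ} {A : MatZ n} (hA : inSigma A) : IsUnit (toR A).det := by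
  rw [toR_det]
  exact hA.1.map (Int.castRingHom ℝ)

lemma toR_nonneg {n : ℕ} {A : MatZ n} (hA : inSigma A) (j k) : 0 ≤ toR A j k := by
  simp only [toR, Matrix.map_apply]
  exact_mod_cast hA.2 j k

lemma sig_one {n : ℕ} : inSigma (1 : MatZ n) := by
  refine ⟨by simp, fun i j => ?_⟩
  rw [Matrix.one_apply]; split_ifs <;> norm_num

lemma sig_mul {n : ℕ} {A B : MatZ n} (hA : inSigma A) (hB : inSigma B) : inSigma (A * B) := by
  refine ⟨by rw [Matrix.det_mul]; exact hA.1.mul hB.1, fun i j => ?_⟩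
  rw [Matrix.mul_apply]
  exact Finset.sum_nonneg fun k _ => mul_nonneg (hA.2 _ _) (hB.2 _ _)

lemma sig_pow {n : ℕ} {A : MatZ n} (hA : inSigma A) (t : ℕ) : inSigma (A ^ t) := by
  induction t with
  | zero => simpa using sig_one
  | succ k ih => rw [pow_succ]; exact sig_mul ih hA

lemma mulVec_nonneg {n : ℕ} {A : MatZ n} (hA : inSigma A) {w : Fin (n+1) → ℝ}
    (hw : ∀ j, 0 ≤ w j) (j) : 0 ≤ (toR A *ᵥ w) j := by
  rw [Matrix.mulVec, dotProduct]
  exact Finset.sum_nonneg fun k _ => mul_nonneg (toR_nonneg hA _ _) (hw _)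

lemma mem_simg' {n : ℕ} {A : MatZ n} (hA : inSigma A) (y : Fin (n+1) → ℝ) :
    y ∈ simg A ↔ ∑ j, y j = 1 ∧ ∃ w : Fin (n+1) → ℝ, (∀ j, 0 ≤ w j) ∧ toR A *ᵥ w = y := by
  constructor
  · rintro ⟨x, hx, rfl⟩
    have hne : toR A *ᵥ x ≠ 0 := by
      intro h
      have h2 : (toR A)⁻¹ *ᵥ (toR A *ᵥ x) = x := by
        rw [Matrix.mulVec_mulVec, Matrix.nonsing_inv_mul _ (toR_unit hA), Matrix.one_mulVec]
      rw [h, Matrix.mulVec_zero] at h2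
      have := hx.2
      rw [← h2] at this
      simp at this
    have hnn := mulVec_nonneg hA hx.1
    have hs : 0 < ∑ j, (toR A *ᵥ x) j := by
      refine lt_of_le_of_ne (Finset.sum_nonneg fun j _ => hnn j) fun h => hne ?_
      funext j
      exact (Finset.sum_eq_zero_iff_of_nonneg (fun j _ => hnn j)).1 h.symm j (Finset.mem_univ _)
    refine ⟨?_, (∑ j, (toR A *ᵥ x) j)⁻¹ • x, fun j => ?_, ?_⟩
    · simp only [projAct, Pi.smul_apply, smul_eq_mul, ← Finset.mul_sum]
      exact inv_mul_cancel₀ hs.ne'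
    · exact mul_nonneg (inv_nonneg.2 hs.le) (hx.1 j)
    · rw [Matrix.mulVec_smul]; rfl
  · rintro ⟨hy, w, hw, rfl⟩
    have hs : 0 < ∑ j, w j := by
      refine lt_of_le_of_ne (Finset.sum_nonneg fun j _ => hw j) fun h => ?_
      have : w = 0 := by
        funext j
        exact (Finset.sum_eq_zero_iff_of_nonneg (fun j _ => hw j)).1 h.symm j (Finset.mem_univ _)
      rw [this] at hy
      simp at hy
    refine ⟨(∑ j, w j)⁻¹ • w, ⟨fun j => mul_nonneg (inv_nonneg.2 hs.le) (hw j), ?_⟩, ?_⟩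
    · simp only [Pi.smul_apply, smul_eq_mul, ← Finset.mul_sum]
      exact inv_mul_cancel₀ hs.ne'
    · rw [projAct, Matrix.mulVec_smul]
      simp only [Pi.smul_apply, smul_eq_mul, ← Finset.mul_sum, hy]
      rw [smul_smul, mul_one, inv_inv, mul_inv_cancel₀ hs.ne', one_smul]

lemma mem_simg {n : ℕ} {A : MatZ n} (hA : inSigma A) (y : Fin (n+1) → ℝ) :
    y ∈ simg A ↔ ∑ j, y j = 1 ∧ ∀ j, 0 ≤ ((toR A)⁻¹ *ᵥ y) j := by
  rw [mem_simg' hA]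
  refine and_congr_right fun _ => ⟨?_, fun h => ⟨_, h, ?_⟩⟩
  · rintro ⟨w, hw, rfl⟩
    rwa [Matrix.mulVec_mulVec, Matrix.nonsing_inv_mul _ (toR_unit hA), Matrix.one_mulVec]
  · rw [Matrix.mulVec_mulVec, Matrix.mul_nonsing_inv _ (toR_unit hA), Matrix.one_mulVec]

lemma simg_sub {n : ℕ} {A : MatZ n} (hA : inSigma A) : simg A ⊆ stdSimplex ℝ (Fin (n+1)) := by
  intro y hy
  obtain ⟨h1, w, hw, rfl⟩ := (mem_simg' hA y).1 hy
  exact ⟨mulVec_nonneg hA hw, h1⟩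

lemma simg_closed {n : ℕ} {A : MatZ n} (hA : inSigma A) : IsClosed (simg A) := by
  have : simg A = {y | ∑ j, y j = 1} ∩ ⋂ j, {y | 0 ≤ ((toR A)⁻¹ *ᵥ y) j} := by
    ext y; rw [mem_simg hA]; simp
  rw [this]
  refine IsClosed.inter (isClosed_eq (by fun_prop) continuous_const) (isClosed_iInter fun j => ?_)
  refine isClosed_le continuous_const ?_
  simp only [Matrix.mulVec, dotProduct]
  fun_prop

lemma simg_compact {n : ℕ} {A : MatZ n} (hA : inSigma A) : IsCompact (simg A) :=
  (isCompact_stdSimplex ℝ _).of_isClosed_subset (simg_closed hA) (simg_sub hA)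

lemma simg_mul_sub {n : ℕ} {A B : MatZ n} (hA : inSigma A) (hB : inSigma B) :
    simg (A * B) ⊆ simg A := by
  intro y hy
  obtain ⟨h1, w, hw, rfl⟩ := (mem_simg' (sig_mul hA hB) y).1 hy
  rw [mem_simg' hA]
  exact ⟨h1, _, mulVec_nonneg hB hw, by rw [toR_mul, Matrix.mulVec_mulVec]⟩

lemma mem_int {n : ℕ} {A : MatZ n} (hA : inSigma A) (y w : Fin (n+1) → ℝ)
    (hy : ∑ j, y j = 1) (hw : ∀ j, 0 < w j) (h : toR A *ᵥ w = y) :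
    y ∈ intrinsicInterior ℝ (simg A) := by
  have hmem : y ∈ simg A := (mem_simg' hA y).2 ⟨hy, w, fun j => (hw j).le, h⟩
  rw [mem_intrinsicInterior]
  refine ⟨⟨y, subset_affineSpan ℝ _ hmem⟩, ?_, rfl⟩
  rw [mem_interior]
  refine ⟨Subtype.val ⁻¹' (⋂ j, {z | 0 < ((toR A)⁻¹ *ᵥ z) j}), ?_, ?_, ?_⟩
  · rintro ⟨z, hz⟩ hz2
    have hz1 : ∑ j, z j = 1 := by
      refine affineSpan_induction (p := fun z => ∑ j, z j = 1) hz
        (fun x hx => ((mem_simg' hA x).1 hx).1) ?_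
      intro c u v w hu hv hw
      simp only [vsub_eq_sub, vadd_eq_add, Pi.add_apply, Pi.smul_apply, Pi.sub_apply, smul_eq_mul,
        Finset.sum_add_distrib, ← Finset.mul_sum, Finset.sum_sub_distrib, hu, hv, hw]
      ring
    simp only [Set.mem_preimage, Set.mem_iInter, Set.mem_ofPred_eq] at hz2 ⊢
    exact (mem_simg hA z).2 ⟨hz1, fun j => (hz2 j).le⟩
  · refine IsOpen.preimage continuous_subtype_val (isOpen_iInter_of_finite fun j => ?_)
    refine isOpen_lt continuous_const ?_
    simp only [Matrix.mulVec, dotProduct]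
    fun_prop
  · simp only [Set.mem_preimage, Set.mem_iInter, Set.mem_ofPred_eq]
    rw [← h, Matrix.mulVec_mulVec, Matrix.nonsing_inv_mul _ (toR_unit hA), Matrix.one_mulVec]
    exact hw

lemma growth (a b : ℕ → ℝ) (K : ℝ) (hK : 1 ≤ K) (hb : ∀ t, 2 ^ t ≤ b t)
    (hab : ∀ t, a (t+1) ≤ a t + K * b t) (T : ℕ) : ∃ t ≥ T, a t ≤ 2 * K * b t := by
  by_contra! hcon
  have h1 : ∀ s, a (T + s) ≤ (3/2) ^ s * a T := by
    intro s
    induction s with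
    | zero => simp
    | succ k ih =>
      have := hcon (T + k) (by omega)
      have h2 := hab (T + k)
      rw [← add_assoc, pow_succ]
      linarith
  obtain ⟨s, hs⟩ := pow_unbounded_of_one_lt (a T) (by norm_num : (1:ℝ) < 4/3)
  have h2 := h1 s
  have h3 := hcon (T + s) (by omega)
  have h4 := hb (T + s)
  have h5 : (2:ℝ) ^ s ≤ 2 ^ (T + s) := pow_le_pow_right₀ (by norm_num) (by omega)
  have h6 : (2:ℝ)^s = (3/2)^s * (4/3)^s := by rw [← mul_pow]; norm_num
  have h7 : (3/2:ℝ)^s * a T < (3/2)^s * (4/3)^s := mul_lt_mul_of_pos_left hs (by positivity)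
  have h8 : 0 < b (T+s) := lt_of_lt_of_le (by positivity) h4
  nlinarith

lemma fix_col {n : ℕ} {E : MatZ n} {i} (h : E *ᵥ Pi.single i 1 = Pi.single i 1) (k) :
    E k i = if k = i then 1 else 0 := by
  have := congrFun h k
  simpa [Pi.single_apply] using this

lemma diag_pow {n : ℕ} {E : MatZ n} (hE : inSigma E) (j) (t : ℕ) :
    (E j j) ^ t ≤ (E ^ t) j j := by
  induction t with
  | zero => simp
  | succ k ih =>
    rw [pow_succ, pow_succ, Matrix.mul_apply]
    refine le_trans (mul_le_mul_of_nonneg_right ih (hE.2 _ _)) ?_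
    exact Finset.single_le_sum (f := fun l => (E ^ k) j l * E l j)
      (fun l _ => mul_nonneg ((sig_pow hE k).2 _ _) (hE.2 _ _)) (Finset.mem_univ j)

lemma lemA {n : ℕ} {E : MatZ n} (hE : inSigma E) (i j : Fin (n+1))
    (hi : E *ᵥ Pi.single i 1 = Pi.single i 1) (hj : 2 ≤ E j j) :
    ¬ ∃ p, (⋂ t : ℕ, simg (E ^ t)) = {p} := by
  rintro ⟨p, hp⟩
  have hcol := fix_col hi
  have hji : j ≠ i := by
    rintro rfl
    have := hcol j
    simp at this; omega
  have hanti : Antitone fun t : ℕ => simg (E ^ t) := by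
    refine antitone_nat_of_succ_le fun t => ?_
    rw [pow_succ]
    exact simg_mul_sub (sig_pow hE t) hE
  have hRi : ∀ t : ℕ, toR (E ^ t) *ᵥ Pi.single i 1 = Pi.single i 1 := by
    intro t
    rw [toR_pow]
    have h1 : toR E *ᵥ Pi.single i 1 = Pi.single i 1 := by
      funext k
      simp [toR, Pi.single_apply, hcol]
    induction t with
    | zero => rw [pow_zero, Matrix.one_mulVec]
    | succ k ih => rw [pow_succ, ← Matrix.mulVec_mulVec, h1, ih]
  have hei : (Pi.single i 1 : Fin (n+1) → ℝ) ∈ ⋂ t : ℕ, simg (E ^ t) := by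
    rw [Set.mem_iInter]
    intro t
    rw [mem_simg' (sig_pow hE t)]
    refine ⟨by simp, Pi.single i 1, fun k => ?_, hRi t⟩
    rw [Pi.single_apply]; split_ifs <;> norm_num
  set K : ℝ := 1 + ∑ k, toR E i k with hKdef
  have hKk : ∀ k, toR E i k ≤ K := fun k => by
    have := Finset.single_le_sum (f := fun k => toR E i k) (fun l _ => toR_nonneg hE i l)
      (Finset.mem_univ k)
    linarith
  have hK1 : 1 ≤ K := by
    have : 0 ≤ ∑ k, toR E i k := Finset.sum_nonneg fun l _ => toR_nonneg hE i l
    linarith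
  let a : ℕ → ℝ := fun t => toR (E ^ t) i j
  let b : ℕ → ℝ := fun t => ∑ k ∈ Finset.univ.erase i, toR (E ^ t) k j
  have hb : ∀ t, 2 ^ t ≤ b t := by
    intro t
    have h1 : (2:ℤ) ^ t ≤ (E ^ t) j j :=
      le_trans (pow_le_pow_left₀ (by norm_num) hj t) (diag_pow hE j t)
    have h2 : (2:ℝ) ^ t ≤ toR (E ^ t) j j := by
      simp only [toR, Matrix.map_apply]; exact_mod_cast h1
    refine h2.trans ?_
    exact Finset.single_le_sum (f := fun k => toR (E ^ t) k j)
      (fun l _ => toR_nonneg (sig_pow hE t) _ _) (Finset.mem_erase.2 ⟨hji, Finset.mem_univ _⟩)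
  have hii : toR E i i = 1 := by simp [toR, hcol]
  have hab : ∀ t, a (t+1) ≤ a t + K * b t := by
    intro t
    simp only [a, b]
    rw [pow_succ', toR_mul, Matrix.mul_apply, ← Finset.add_sum_erase _ _ (Finset.mem_univ i), hii,
      one_mul, Finset.mul_sum]
    gcongr with k hk
    · exact toR_nonneg (sig_pow hE t) _ _
    · exact hKk k
  have hKt : ∀ t, (simg (E ^ t) ∩ {x | x i * (2 * K + 1) ≤ 2 * K}).Nonempty := by
    intro T
    obtain ⟨t, ht, hle⟩ := growth a b K hK1 hb hab T
    have hbp : 0 < b t := lt_of_lt_of_le (by positivity) (hb t)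
    have hap : 0 ≤ a t := toR_nonneg (sig_pow hE t) _ _
    have hsum : ∑ k, toR (E ^ t) k j = a t + b t :=
      (Finset.add_sum_erase _ _ (Finset.mem_univ i)).symm
    have hv : toR (E ^ t) *ᵥ Pi.single j ((a t + b t)⁻¹) =
        fun k => toR (E ^ t) k j * (a t + b t)⁻¹ := by
      funext k; simp
    refine ⟨fun k => toR (E ^ t) k j * (a t + b t)⁻¹, hanti ht ?_, ?_⟩
    · simp only
      rw [mem_simg' (sig_pow hE t)]
      refine ⟨?_, Pi.single j ((a t + b t)⁻¹), fun k => ?_, hv⟩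
      · rw [← Finset.sum_mul, hsum, mul_inv_cancel₀]; positivity
      · rw [Pi.single_apply]; split_ifs
        · positivity
        · exact le_rfl
    · simp only [Set.mem_ofPred_eq]
      change a t * (a t + b t)⁻¹ * (2 * K + 1) ≤ 2 * K
      rw [← div_eq_mul_inv, div_mul_eq_mul_div, div_le_iff₀ (by positivity)]
      nlinarith
  have hclosed : IsClosed {x : Fin (n+1) → ℝ | x i * (2 * K + 1) ≤ 2 * K} :=
    isClosed_le (by fun_prop) continuous_const
  obtain ⟨q, hq⟩ := IsCompact.nonempty_iInter_of_sequence_nonempty_isCompact_isClosed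
    (fun t : ℕ => simg (E ^ t) ∩ {x | x i * (2 * K + 1) ≤ 2 * K})
    (fun t => Set.inter_subset_inter_left _ (hanti (Nat.le_succ t))) hKt
    ((simg_compact (sig_pow hE 0)).inter_right hclosed)
    (fun t => (simg_closed (sig_pow hE t)).inter hclosed)
  rw [Set.mem_iInter] at hq
  have hq1 : q ∈ ⋂ t : ℕ, simg (E ^ t) := Set.mem_iInter.2 fun t => (hq t).1
  have hq2 := (hq 0).2
  rw [hp] at hq1 hei
  rw [Set.mem_singleton_iff] at hq1 hei
  rw [hq1, ← hei] at hq2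
  simp at hq2
  linarith

lemma exists_pow_diag {n : ℕ} {E : MatZ n} (hE : inSigma E) :
    ∃ m : ℕ, 0 < m ∧ ∀ j, 1 ≤ (E ^ m) j j := by
  have hdet : E.det ≠ 0 := hE.1.ne_zero
  rw [Matrix.det_apply] at hdet
  obtain ⟨σ, -, hσ⟩ := Finset.exists_ne_zero_of_sum_ne_zero hdet
  have hp : ∏ j, E (σ j) j ≠ 0 := fun h => hσ (by rw [h, smul_zero])
  have h1 : ∀ j, 1 ≤ E (σ j) j := fun j => by
    have := Finset.prod_ne_zero_iff.1 hp j (Finset.mem_univ _)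
    have := hE.2 (σ j) j
    omega
  have h2 : ∀ m : ℕ, ∀ j, 1 ≤ (E ^ m) ((σ ^ m) j) j := by
    intro m
    induction m with
    | zero => simp
    | succ k ih =>
      intro j
      rw [pow_succ, pow_succ, Matrix.mul_apply]
      have := Finset.single_le_sum (f := fun l => (E ^ k) ((σ ^ k * σ) j) l * E l j)
        (fun l _ => mul_nonneg ((sig_pow hE k).2 _ _) (hE.2 _ _)) (Finset.mem_univ (σ j))
      refine le_trans ?_ this
      have h3 := ih (σ j)
      have h4 := h1 j
      simp only [Equiv.Perm.mul_apply]
      nlinarith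
  refine ⟨orderOf σ, orderOf_pos σ, fun j => ?_⟩
  have := h2 (orderOf σ) j
  rwa [pow_orderOf_eq_one] at this

lemma tri_solve {n : ℕ} {P : MatZ n} (hP : inSigma P) (h : Fin (n+1) → ℕ)
    (hd : ∀ j, P j j = 1) (hs : ∀ j k, j ≠ k → 0 < P j k → h k < h j)
    (L : ℝ) (hL : ∀ j, ∑ k, toR P j k ≤ L) :
    ∃ u : Fin (n+1) → ℝ, (∀ j, 0 < u j) ∧ toR P *ᵥ u = fun j => L ^ h j := by
  have hL1 : 1 ≤ L := by
    refine le_trans ?_ (hL 0)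
    have := Finset.single_le_sum (f := fun k => toR P 0 k) (fun l _ => toR_nonneg hP 0 l)
      (Finset.mem_univ 0)
    simpa [toR, hd] using this
  set u := (toR P)⁻¹ *ᵥ (fun j => L ^ h j) with hu
  have hPu : toR P *ᵥ u = fun j => L ^ h j := by
    rw [hu, Matrix.mulVec_mulVec, Matrix.mul_nonsing_inv _ (toR_unit hP), Matrix.one_mulVec]
  have hdR : ∀ j, toR P j j = 1 := fun j => by simp [toR, hd]
  have key : ∀ N : ℕ, ∀ j, h j = N → 0 < u j ∧ u j ≤ L ^ h j := by
    intro N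
    induction N using Nat.strong_induction_on with
    | _ N ih =>
    intro j hj
    have e := congrFun hPu j
    simp only [Matrix.mulVec, dotProduct] at e
    rw [← Finset.add_sum_erase _ _ (Finset.mem_univ j), hdR, one_mul] at e
    have hz : ∀ k ∈ Finset.univ.erase j, toR P j k = 0 ∨ (h k < h j) := by
      intro k hk
      have hkj := (Finset.mem_erase.1 hk).1
      rcases (hP.2 j k).eq_or_lt with h0 | h0
      · left; simp [toR, ← h0]
      · right; exact hs j k hkj.symm h0
    have lo : 0 ≤ ∑ k ∈ Finset.univ.erase j, toR P j k * u k := by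
      refine Finset.sum_nonneg fun k hk => ?_
      rcases hz k hk with h0 | h0
      · simp [h0]
      · exact mul_nonneg (toR_nonneg hP _ _) (ih _ (hj ▸ h0) k rfl).1.le
    have hrow : ∑ k ∈ Finset.univ.erase j, toR P j k ≤ L - 1 := by
      have := hL j
      rw [← Finset.add_sum_erase _ _ (Finset.mem_univ j), hdR] at this
      linarith
    have hi : ∑ k ∈ Finset.univ.erase j, toR P j k * u k < L ^ h j := by
      rcases Nat.eq_zero_or_pos (h j) with h0 | h0
      · have : ∑ k ∈ Finset.univ.erase j, toR P j k * u k = 0 := by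
          refine Finset.sum_eq_zero fun k hk => ?_
          rcases hz k hk with h1 | h1
          · simp [h1]
          · omega
        rw [this]; positivity
      · have h1 : ∑ k ∈ Finset.univ.erase j, toR P j k * u k
            ≤ ∑ k ∈ Finset.univ.erase j, toR P j k * L ^ (h j - 1) := by
          refine Finset.sum_le_sum fun k hk => ?_
          rcases hz k hk with h1 | h1
          · simp [h1]
          · refine mul_le_mul_of_nonneg_left ?_ (toR_nonneg hP _ _)
            exact (ih _ (hj ▸ h1) k rfl).2.trans (pow_le_pow_right₀ hL1 (by omega))
        rw [← Finset.sum_mul] at h1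
        have h2 : L ^ h j = L * L ^ (h j - 1) := by
          rw [← pow_succ']; congr 1; omega
        have h3 : 0 < L ^ (h j - 1) := by positivity
        nlinarith
    constructor <;> linarith
  exact ⟨u, fun j => (key _ j rfl).1, hPu⟩

lemma mulVec_pos {n : ℕ} {A : MatZ n} (hA : inSigma A) {w : Fin (n+1) → ℝ}
    (hw : ∀ j, 0 < w j) (j) : 0 < (toR A *ᵥ w) j := by
  have hnn : ∀ k ∈ Finset.univ, 0 ≤ toR A j k * w k :=
    fun k _ => mul_nonneg (toR_nonneg hA _ _) (hw k).le
  rw [Matrix.mulVec, dotProduct]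
  refine lt_of_le_of_ne (Finset.sum_nonneg hnn) fun h => ?_
  have h1 := (Finset.sum_eq_zero_iff_of_nonneg hnn).1 h.symm
  have h2 : (toR A).det = 0 := Matrix.det_eq_zero_of_row_eq_zero j fun k => by
    have := h1 k (Finset.mem_univ _)
    rcases mul_eq_zero.1 this with h3 | h3
    · exact h3
    · exact absurd h3 (hw k).ne'
  exact (toR_unit hA).ne_zero h2

end S10

open S10 in
theorem stmt10 (n : ℕ) (hn : 1 ≤ n) (C D : MatZ n) (hC : inSigma C) (hD : inSigma D)
    (i : Fin (n + 1))
    (hCi : C *ᵥ Pi.single i 1 = Pi.single i 1)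
    (hDi : D *ᵥ Pi.single i 1 = Pi.single i 1)
    (hdisj : Disjoint (intrinsicInterior ℝ (simg C)) (intrinsicInterior ℝ (simg D))) :
    ∃ E : MatZ n,
      (∃ l : List (MatZ n), l ≠ [] ∧ (∀ X ∈ l, X = C ∨ X = D) ∧ E = l.prod) ∧
      ¬ ∃ p, (⋂ t : ℕ, simg (E ^ t)) = {p} := by
  set M : Submonoid (MatZ n) := Submonoid.closure {C, D} with hM
  have hCM : C ∈ M := Submonoid.subset_closure (by simp)
  have hDM : D ∈ M := Submonoid.subset_closure (by simp)
  have hMs : ∀ E ∈ M, inSigma E ∧ E *ᵥ Pi.single i 1 = Pi.single i 1 := by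
    intro E hE
    induction hE using Submonoid.closure_induction with
    | mem x hx =>
      rcases hx with rfl | rfl
      · exact ⟨hC, hCi⟩
      · exact ⟨hD, hDi⟩
    | one => exact ⟨sig_one, Matrix.one_mulVec _⟩
    | mul x y _ _ hx hy =>
      exact ⟨sig_mul hx.1 hy.1, by rw [← Matrix.mulVec_mulVec, hy.2, hx.2]⟩
  by_cases hbig : ∃ E ∈ M, ∃ j, 2 ≤ E j j
  · obtain ⟨E, hE, j, hj⟩ := hbig
    refine ⟨E, ?_, lemA (hMs E hE).1 i j (hMs E hE).2 hj⟩
    obtain ⟨l, hl, rfl⟩ := Submonoid.exists_list_of_mem_closure hE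
    refine ⟨l, ?_, fun X hX => by simpa using hl X hX, rfl⟩
    rintro rfl
    simp at hj
  exfalso
  push Not at hbig
  classical
  let R : Fin (n+1) → Fin (n+1) → Prop := fun j k => ∃ F ∈ M, 0 < F j k
  have hRr : ∀ j, R j j := fun j => ⟨1, M.one_mem, by simp⟩
  have hle : ∀ E ∈ M, ∀ F ∈ M, ∀ j k l, E j k * F k l ≤ (E * F) j l := by
    intro E hE F hF j k l
    rw [Matrix.mul_apply]
    exact Finset.single_le_sum (f := fun k => E j k * F k l)
      (fun k _ => mul_nonneg ((hMs E hE).1.2 _ _) ((hMs F hF).1.2 _ _)) (Finset.mem_univ k)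
  have hRt : ∀ j k l, R j k → R k l → R j l := by
    rintro j k l ⟨E, hE, h1⟩ ⟨F, hF, h2⟩
    exact ⟨E * F, M.mul_mem hE hF, lt_of_lt_of_le (mul_pos h1 h2) (hle E hE F hF j k l)⟩
  let h : Fin (n+1) → ℕ := fun j => (Finset.univ.filter fun k => R j k).card
  have htri : ∀ P ∈ M, (∀ j, 1 ≤ P j j) →
      (∀ j, P j j = 1) ∧ ∀ j k, j ≠ k → 0 < P j k → h k < h j := by
    intro P hP hd
    have hd1 : ∀ j, P j j = 1 := fun j => by
      have := hd j
      have := hbig P hP j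
      omega
    refine ⟨hd1, fun j k hjk hpos => ?_⟩
    have hnR : ¬ R k j := by
      rintro ⟨F, hF, hFp⟩
      have h1 : 2 ≤ (P * P) j k := by
        rw [Matrix.mul_apply]
        have := Finset.sum_le_sum_of_subset_of_nonneg (f := fun l => P j l * P l k)
          (Finset.subset_univ {j, k})
          (fun l _ _ => mul_nonneg ((hMs P hP).1.2 _ _) ((hMs P hP).1.2 _ _))
        rw [Finset.sum_pair hjk, hd1, hd1] at this
        omega
      have h2 := hle (P * P) (M.mul_mem hP hP) F hF j k j
      have h3 := hbig _ (M.mul_mem (M.mul_mem hP hP) hF) j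
      nlinarith
    refine Finset.card_lt_card ?_
    rw [Finset.ssubset_iff_of_subset]
    · exact ⟨j, by simp [hRr], by simpa using hnR⟩
    · intro l hl
      simp only [Finset.mem_filter, Finset.mem_univ, true_and] at hl ⊢
      exact hRt j k l ⟨P, hP, hpos⟩ hl
  obtain ⟨m, hm, hCm⟩ := exists_pow_diag hC
  obtain ⟨m', hm', hDm⟩ := exists_pow_diag hD
  obtain ⟨c1, c2⟩ := htri _ (M.pow_mem hCM m) hCm
  obtain ⟨d1, d2⟩ := htri _ (M.pow_mem hDM m') hDm
  have hrow : ∀ A : MatZ n, inSigma A → ∀ j, ∑ k, toR A j k ≤ ∑ j, ∑ k, toR A j k :=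
    fun A hA j => Finset.single_le_sum (f := fun j => ∑ k, toR A j k)
      (fun j _ => Finset.sum_nonneg fun k _ => toR_nonneg hA _ _) (Finset.mem_univ j)
  set L : ℝ := max (∑ j, ∑ k, toR (C ^ m) j k) (∑ j, ∑ k, toR (D ^ m') j k) + 1 with hLdef
  obtain ⟨u, hu, hux⟩ := tri_solve (sig_pow hC m) h c1 c2 L fun j => by
    have := hrow _ (sig_pow hC m) j
    have := le_max_left (∑ j, ∑ k, toR (C ^ m) j k) (∑ j, ∑ k, toR (D ^ m') j k)
    linarith
  obtain ⟨v, hv, hvx⟩ := tri_solve (sig_pow hD m') h d1 d2 L fun j => by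
    have := hrow _ (sig_pow hD m') j
    have := le_max_right (∑ j, ∑ k, toR (C ^ m) j k) (∑ j, ∑ k, toR (D ^ m') j k)
    linarith
  set x : Fin (n+1) → ℝ := fun j => L ^ h j with hx
  have hxp : ∀ j, 0 < x j := fun j => by
    rw [← hux]; exact mulVec_pos (sig_pow hC m) hu j
  have hS : 0 < ∑ j, x j := Finset.sum_pos (fun j _ => hxp j) Finset.univ_nonempty
  have fin : ∀ (A : MatZ n) (m : ℕ) (u : Fin (n+1) → ℝ), inSigma A → 0 < m → (∀ j, 0 < u j) →
      toR (A ^ m) *ᵥ u = x → (∑ j, x j)⁻¹ • x ∈ intrinsicInterior ℝ (simg A) := by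
    intro A m u hA hm hu hux
    obtain ⟨r, rfl⟩ := Nat.exists_eq_succ_of_ne_zero hm.ne'
    refine mem_int hA _ ((∑ j, x j)⁻¹ • (toR (A ^ r) *ᵥ u)) ?_ (fun j => ?_) ?_
    · simp only [Pi.smul_apply, smul_eq_mul, ← Finset.mul_sum]
      exact inv_mul_cancel₀ hS.ne'
    · exact mul_pos (inv_pos.2 hS) (mulVec_pos (sig_pow hA r) hu j)
    · rw [Matrix.mulVec_smul, Matrix.mulVec_mulVec, ← toR_mul, ← pow_succ', hux]
  exact Set.disjoint_left.1 hdisj (fin C m u hC hm hu hux) (fin D m' v hD hm' hv hvx)
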